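/- (Gradient of the weighted barycentric objective on the unit sphere.) Let E be a real inner product space, let p_1, …, p_k, q ∈ E be unit vectors with −1 < ⟨q, p_j⟩ < 1 for all j, and let w_1, …, w_k ∈ ℝ. Let γ : ℝ → E be differentiable at 0 with ‖γ(t)‖ = 1 for all t and γ(0) = q. Then the weighted objective along γ, t ↦ ½ Σ_{j=1}^k w_j arccos(⟨γ(t), p_j⟩)², is differentiable at 0 with derivative ⟨−Σ_{j=1}^k w_j Log_q(p_j), γ'(0)⟩; that is, the Riemannian gradient of q ↦ ½ Σ_j w_j dist(q, p_j)² on the sphere equals −Σ_j w_j Log_q(p_j). -/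

import Mathlib

open RealInnerProductSpace

/-- Norm of the component of a unit vector orthogonal to another unit vector. -/
lemma norm_sub_inner_smul_eq_sqrt
    {E : Type*} [NormedAddCommGroup E] [InnerProductSpace ℝ E] {p q : E}
    (hp : ‖p‖ = 1) (hq : ‖q‖ = 1) :
    ‖p - inner ℝ q p • q‖ = √(1 - inner ℝ q p ^ 2) := by
  rw [← Real.sqrt_sq (norm_nonneg (p - inner ℝ q p • q)), norm_sub_sq_real, norm_smul, hp, hq,
    inner_smul_right, real_inner_comm q p, mul_one, Real.norm_eq_abs, sq_abs]
  ring_nf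

/-- A differentiable curve of constant unit norm is orthogonal to its velocity. -/
lemma inner_deriv_eq_zero_of_norm_eq_one
    {E : Type*} [NormedAddCommGroup E] [InnerProductSpace ℝ E] {γ : ℝ → E} {v : E} {t : ℝ}
    (hγd : HasDerivAt γ v t) (hγ : ∀ t, ‖γ t‖ = 1) : inner ℝ (γ t) v = 0 := by
  have h := hγd.norm_sq
  simp only [hγ] at h
  have := h.unique (hasDerivAt_const t _)
  linarith

/-- Derivative of half the squared spherical distance to a fixed point along a spherical curve. -/
lemma hasDerivAt_arccos_inner_sq
    {E : Type*} [NormedAddCommGroup E] [InnerProductSpace ℝ E] {γ : ℝ → E} {v p : E} {t : ℝ}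
    (hγd : HasDerivAt γ v t) (hγ : ∀ t, ‖γ t‖ = 1) (hp : ‖p‖ = 1)
    (h1 : -1 < inner ℝ (γ t) p) (h2 : inner ℝ (γ t) p < 1) :
    HasDerivAt (fun s => Real.arccos (inner ℝ (γ s) p) ^ 2)
      (-2 * inner ℝ (Real.arccos (inner ℝ (γ t) p) •
        (‖p - inner ℝ (γ t) p • γ t‖⁻¹ • (p - inner ℝ (γ t) p • γ t))) v) t := by
  have hc : HasDerivAt (fun s => inner ℝ (γ s) p) (inner ℝ v p) t := by
    simpa using hγd.inner ℝ (hasDerivAt_const t p)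
  have h := ((Real.hasDerivAt_arccos h1.ne' h2.ne).comp t hc).pow 2
  refine h.congr_deriv ?_
  rw [norm_sub_inner_smul_eq_sqrt hp (hγ t)]
  simp only [inner_smul_left, inner_sub_left, inner_deriv_eq_zero_of_norm_eq_one hγd hγ,
    real_inner_comm v p, Function.comp_apply, conj_trivial]
  simp
  ring

/-- Gradient of the weighted barycentric objective on the unit sphere: along any
curve `γ` on the sphere with `γ(0) = q` and `γ'(0) = v`, the weighted objective
`t ↦ ½ ∑ j, w j * arccos(⟨γ(t), p j⟩)²` has derivative
`⟨-∑ j, w j • Log_q(p j), v⟩` at `t = 0`; i.e. the Riemannian gradient of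
`q ↦ ½ ∑ j, w j * dist(q, p j)²` is `-∑ j, w j • Log_q(p j)`. -/
theorem weighted_barycentric_gradient_sphere
    {E : Type*} [NormedAddCommGroup E] [InnerProductSpace ℝ E]
    {k : ℕ} (p : Fin k → E) (q : E)
    (hp : ∀ j, ‖p j‖ = 1) (hq : ‖q‖ = 1)
    (h1 : ∀ j, -1 < ⟪q, p j⟫) (h2 : ∀ j, ⟪q, p j⟫ < 1)
    (w : Fin k → ℝ)
    (γ : ℝ → E) (hγ : ∀ t, ‖γ t‖ = 1) (hγ0 : γ 0 = q)
    (v : E) (hγd : HasDerivAt γ v 0) :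
    HasDerivAt (fun t : ℝ => (1/2 : ℝ) * ∑ j, w j * (Real.arccos ⟪γ t, p j⟫) ^ 2)
      ⟪-(∑ j, w j • (Real.arccos ⟪q, p j⟫ •
          (‖p j - ⟪q, p j⟫ • q‖⁻¹ • (p j - ⟪q, p j⟫ • q)))), v⟫ 0 := by
  subst hγ0
  have h := (HasDerivAt.fun_sum (u := Finset.univ) fun j _ =>
    (hasDerivAt_arccos_inner_sq hγd hγ (hp j) (h1 j) (h2 j)).const_mul (w j)).const_mul (1 / 2 : ℝ)
  refine h.congr_deriv ?_
  rw [inner_neg_left, sum_inner, Finset.mul_sum, ← Finset.sum_neg_distrib]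
  refine Finset.sum_congr rfl fun j _ => ?_
  rw [real_inner_smul_left _ _ (w j)]
  ring
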